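/- Let τ ∈ ℂ with Im τ > 0 and θ(z) = θ₁(z,τ). Let w, X, Y, Z, Z' ∈ ℂ be such that θ(X−Z), θ(Y−Z'), θ(w−X+Z'−Z) and θ(w−Y) are all nonzero. Define X₃ = [θ(X−Z')·θ(Y−Z)·θ(w−X)·θ(w−Y+Z'−Z)] / [θ(X−Z)·θ(Y−Z')·θ(w−X+Z'−Z)·θ(w−Y)] and Y₃ = [θ(Z−Z')·θ(X−Y)·θ(w−Z)·θ(w−Y+Z'−X)] / [θ(X−Z)·θ(Y−Z')·θ(w−X+Z'−Z)·θ(w−Y)]. Then X₃ + Y₃ = 1. (This is the Fermat relation x₃^N + y₃^N = 1 for the third Fermat point of the theta-function parameterized R-matrix, in genus one.) -/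

import Mathlib

/-- The odd Jacobi theta function
`θ₁(z,τ) = -i ∑_{n ∈ ℤ} (-1)^n exp(iπτ(n+1/2)²) exp((2n+1)iπz)`. -/
noncomputable def theta1 (z τ : ℂ) : ℂ :=
  -Complex.I * ∑' n : ℤ,
    (-1 : ℂ) ^ n * Complex.exp ((Real.pi : ℂ) * Complex.I * τ * ((n : ℂ) + 1 / 2) ^ 2) *
      Complex.exp ((2 * (n : ℂ) + 1) * (Real.pi : ℂ) * Complex.I * z)

open Complex in
/-- The general term of the series defining `theta1`. -/
noncomputable def theta1Term (τ z : ℂ) (n : ℤ) : ℂ :=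
  (-1 : ℂ) ^ n * exp ((Real.pi : ℂ) * I * τ * ((n : ℂ) + 1 / 2) ^ 2) *
    exp ((2 * (n : ℂ) + 1) * (Real.pi : ℂ) * I * z)

lemma neg_one_zpow_eq_exp (n : ℤ) : (-1 : ℂ) ^ n = Complex.exp (n * (Real.pi * Complex.I)) := by
  rw [Complex.exp_int_mul, Complex.exp_pi_mul_I]

lemma summable_theta1Term {τ : ℂ} (hτ : 0 < τ.im) (z : ℂ) : Summable (theta1Term τ z) := by
  have h := ((summable_jacobiTheta₂_term_iff (z + τ / 2 + 1 / 2) τ).2 hτ).mul_left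
    (Complex.exp (Real.pi * Complex.I * (τ / 4 + z)))
  refine h.congr fun n => ?_
  rw [theta1Term, jacobiTheta₂_term, neg_one_zpow_eq_exp, ← Complex.exp_add, ← Complex.exp_add,
    ← Complex.exp_add]
  congr 1
  ring

/-- The even-index part of the series for `jacobiTheta₂ x (τ / 2)`. -/
noncomputable def thetaEven (τ x : ℂ) : ℂ := ∑' k : ℤ, jacobiTheta₂_term (2 * k) x (τ / 2)

/-- The odd-index part of the series for `jacobiTheta₂ x (τ / 2)`. -/
noncomputable def thetaOdd (τ x : ℂ) : ℂ := ∑' k : ℤ, jacobiTheta₂_term (2 * k + 1) x (τ / 2)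

lemma summable_thetaEven {τ : ℂ} (hτ : 0 < τ.im) (x : ℂ) :
    Summable fun k : ℤ => jacobiTheta₂_term (2 * k) x (τ / 2) := by
  have h := (summable_jacobiTheta₂_term_iff x (τ / 2)).2 (by simpa using hτ)
  exact h.comp_injective (i := fun k : ℤ => 2 * k) fun a b hab => by simpa using hab

lemma summable_thetaOdd {τ : ℂ} (hτ : 0 < τ.im) (x : ℂ) :
    Summable fun k : ℤ => jacobiTheta₂_term (2 * k + 1) x (τ / 2) := by
  have h := (summable_jacobiTheta₂_term_iff x (τ / 2)).2 (by simpa using hτ)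
  exact h.comp_injective (i := fun k : ℤ => 2 * k + 1) fun a b hab => by simpa using hab

lemma hasSum_mul_of_summable {f g : ℤ → ℂ} (hf : Summable f) (hg : Summable g) :
    HasSum (fun p : ℤ × ℤ => f p.1 * g p.2) ((∑' n, f n) * ∑' n, g n) :=
  hf.hasSum.mul hg.hasSum (summable_mul_of_summable_norm hf.norm hg.norm)

/-- Parametrization of the pairs of integers with odd sum. -/
def oddSumPair (p : ℤ × ℤ) : ℤ × ℤ := (p.1 + p.2, p.1 - p.2 - 1)

/-- Parametrization of the pairs of integers with even sum. -/
def evenSumPair (p : ℤ × ℤ) : ℤ × ℤ := (p.1 + p.2, p.1 - p.2)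

lemma oddSumPair_injective : Function.Injective oddSumPair := by
  rintro ⟨a, b⟩ ⟨c, d⟩ h
  simp only [oddSumPair, Prod.mk.injEq] at h ⊢
  lia

lemma evenSumPair_injective : Function.Injective evenSumPair := by
  rintro ⟨a, b⟩ ⟨c, d⟩ h
  simp only [evenSumPair, Prod.mk.injEq] at h ⊢
  lia

lemma isCompl_range_oddSumPair_evenSumPair :
    IsCompl (Set.range oddSumPair) (Set.range evenSumPair) := by
  constructor
  · rw [Set.disjoint_left]
    rintro _ ⟨⟨a, b⟩, rfl⟩ ⟨⟨c, d⟩, h⟩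
    simp only [oddSumPair, evenSumPair, Prod.mk.injEq] at h
    lia
  · rw [codisjoint_iff_le_sup]
    rintro ⟨n, m⟩ -
    rcases Int.even_or_odd' (n + m) with ⟨j, hj | hj⟩
    · exact Or.inr ⟨(j, n - j), by simp only [evenSumPair, Prod.mk.injEq]; lia⟩
    · exact Or.inl ⟨(j + 1, n - j - 1), by simp only [oddSumPair, Prod.mk.injEq]; lia⟩

lemma theta1Term_mul_oddSumPair (τ x y : ℂ) (p : ℤ × ℤ) :
    theta1Term τ (x + y) (oddSumPair p).1 * theta1Term τ (x - y) (oddSumPair p).2 =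
      -(jacobiTheta₂_term (2 * p.1) x (τ / 2) * jacobiTheta₂_term (2 * p.2 + 1) y (τ / 2)) := by
  obtain ⟨j, k⟩ := p
  have hs : (-1 : ℂ) ^ (j + k) * (-1 : ℂ) ^ (j - k - 1) = -1 := by
    rw [← zpow_add₀ (by norm_num)]
    exact Odd.neg_one_zpow ⟨j - 1, by ring⟩
  simp only [theta1Term, oddSumPair, jacobiTheta₂_term]
  rw [mul_assoc ((-1 : ℂ) ^ (j + k)), mul_assoc ((-1 : ℂ) ^ (j - k - 1)), 
    mul_mul_mul_comm, hs, neg_one_mul]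
  simp only [← Complex.exp_add]
  push_cast
  ring_nf

lemma theta1Term_mul_evenSumPair (τ x y : ℂ) (p : ℤ × ℤ) :
    theta1Term τ (x + y) (evenSumPair p).1 * theta1Term τ (x - y) (evenSumPair p).2 =
      jacobiTheta₂_term (2 * p.1 + 1) x (τ / 2) * jacobiTheta₂_term (2 * p.2) y (τ / 2) := by
  obtain ⟨j, k⟩ := p
  have hs : (-1 : ℂ) ^ (j + k) * (-1 : ℂ) ^ (j - k) = 1 := by
    rw [← zpow_add₀ (by norm_num)]
    exact Even.neg_one_zpow ⟨j, by ring⟩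
  simp only [theta1Term, evenSumPair, jacobiTheta₂_term]
  rw [mul_assoc ((-1 : ℂ) ^ (j + k)), mul_assoc ((-1 : ℂ) ^ (j - k)), mul_mul_mul_comm, hs, one_mul]
  simp only [← Complex.exp_add]
  push_cast
  ring_nf

/-- The addition formula writing `θ₁(x + y) θ₁(x - y)` as a `2 × 2` determinant. -/
lemma theta1_add_mul_theta1_sub {τ : ℂ} (hτ : 0 < τ.im) (x y : ℂ) :
    theta1 (x + y) τ * theta1 (x - y) τ =
      thetaEven τ x * thetaOdd τ y - thetaOdd τ x * thetaEven τ y := by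
  have hodd := (hasSum_mul_of_summable (summable_thetaEven hτ x) (summable_thetaOdd hτ y)).neg
  have heven := hasSum_mul_of_summable (summable_thetaOdd hτ x) (summable_thetaEven hτ y)
  simp only [← theta1Term_mul_oddSumPair] at hodd
  simp only [← theta1Term_mul_evenSumPair] at heven
  let F : ℤ × ℤ → ℂ := fun p => theta1Term τ (x + y) p.1 * theta1Term τ (x - y) p.2
  have h := HasSum.add_isCompl (f := F) isCompl_range_oddSumPair_evenSumPair
    (oddSumPair_injective.hasSum_range_iff.2 hodd)
    (evenSumPair_injective.hasSum_range_iff.2 heven)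
  have key := (hasSum_mul_of_summable (summable_theta1Term hτ (x + y))
    (summable_theta1Term hτ (x - y))).unique h
  have e (z : ℂ) : theta1 z τ = -Complex.I * ∑' n, theta1Term τ z n := rfl
  rw [e, e, mul_mul_mul_comm, key, neg_mul_neg, Complex.I_mul_I]
  simp only [thetaEven, thetaOdd]
  ring

lemma theta1_neg {τ : ℂ} (hτ : 0 < τ.im) (z : ℂ) : theta1 (-z) τ = -theta1 z τ := by
  by_cases h : ∀ u, theta1 u τ = 0
  · simp [h]
  · obtain ⟨u, hu⟩ := not_forall.1 h
    have h1 := theta1_add_mul_theta1_sub hτ ((u + z) / 2) ((u - z) / 2)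
    have h2 := theta1_add_mul_theta1_sub hτ ((u - z) / 2) ((u + z) / 2)
    rw [show (u + z) / 2 + (u - z) / 2 = u by ring,
      show (u + z) / 2 - (u - z) / 2 = z by ring] at h1
    rw [show (u - z) / 2 + (u + z) / 2 = u by ring,
      show (u - z) / 2 - (u + z) / 2 = -z by ring] at h2
    apply mul_left_cancel₀ hu
    linear_combination h1 + h2

/-- The three-term (Weierstrass) identity for `theta1`. -/
lemma theta1_weierstrass {τ : ℂ} (hτ : 0 < τ.im) (a b c d : ℂ) :
    (theta1 (a + b) τ * theta1 (a - b) τ) * (theta1 (c + d) τ * theta1 (c - d) τ) -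
      (theta1 (a + c) τ * theta1 (a - c) τ) * (theta1 (b + d) τ * theta1 (b - d) τ) +
      (theta1 (a + d) τ * theta1 (a - d) τ) * (theta1 (b + c) τ * theta1 (b - c) τ) = 0 := by
  simp only [theta1_add_mul_theta1_sub hτ]
  ring

/-- Genus-one Fermat relation `x₃^N + y₃^N = 1` for the third Fermat
point of the theta-function parameterized R-matrix: with `θ(z) = θ₁(z,τ)`, `Im τ > 0`,
and the stated denominators nonzero,
`X₃ = θ(X-Z')θ(Y-Z)θ(w-X)θ(w-Y+Z'-Z) / (θ(X-Z)θ(Y-Z')θ(w-X+Z'-Z)θ(w-Y))` and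
`Y₃ = θ(Z-Z')θ(X-Y)θ(w-Z)θ(w-Y+Z'-X) / (θ(X-Z)θ(Y-Z')θ(w-X+Z'-Z)θ(w-Y))`
satisfy `X₃ + Y₃ = 1`. -/
theorem theta1_fermat_relation_third (τ : ℂ) (hτ : 0 < τ.im)
    (w X Y Z Z' : ℂ)
    (h1 : theta1 (X - Z) τ ≠ 0) (h2 : theta1 (Y - Z') τ ≠ 0)
    (h3 : theta1 (w - X + Z' - Z) τ ≠ 0) (h4 : theta1 (w - Y) τ ≠ 0) :
    (theta1 (X - Z') τ * theta1 (Y - Z) τ * theta1 (w - X) τ *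
        theta1 (w - Y + Z' - Z) τ) /
      (theta1 (X - Z) τ * theta1 (Y - Z') τ * theta1 (w - X + Z' - Z) τ *
        theta1 (w - Y) τ) +
    (theta1 (Z - Z') τ * theta1 (X - Y) τ * theta1 (w - Z) τ *
        theta1 (w - Y + Z' - X) τ) /
      (theta1 (X - Z) τ * theta1 (Y - Z') τ * theta1 (w - X + Z' - Z) τ *
        theta1 (w - Y) τ) = 1 := by
  have key := theta1_weierstrass hτ ((w + Z' - 2 * Z) / 2) ((2 * X - w - Z') / 2)
    ((w - Z') / 2) ((2 * Y - Z' - w) / 2)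
  rw [show (w + Z' - 2 * Z) / 2 + (2 * X - w - Z') / 2 = X - Z by ring,
    show (w + Z' - 2 * Z) / 2 - (2 * X - w - Z') / 2 = w - X + Z' - Z by ring,
    show (w - Z') / 2 + (2 * Y - Z' - w) / 2 = Y - Z' by ring,
    show (w - Z') / 2 - (2 * Y - Z' - w) / 2 = w - Y by ring,
    show (w + Z' - 2 * Z) / 2 + (w - Z') / 2 = w - Z by ring,
    show (w + Z' - 2 * Z) / 2 - (w - Z') / 2 = -(Z - Z') by ring,
    show (2 * X - w - Z') / 2 + (2 * Y - Z' - w) / 2 = -(w - Y + Z' - X) by ring,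
    show (2 * X - w - Z') / 2 - (2 * Y - Z' - w) / 2 = X - Y by ring,
    show (w + Z' - 2 * Z) / 2 + (2 * Y - Z' - w) / 2 = Y - Z by ring,
    show (w + Z' - 2 * Z) / 2 - (2 * Y - Z' - w) / 2 = w - Y + Z' - Z by ring,
    show (2 * X - w - Z') / 2 + (w - Z') / 2 = X - Z' by ring,
    show (2 * X - w - Z') / 2 - (w - Z') / 2 = -(w - X) by ring,
    theta1_neg hτ (Z - Z'), theta1_neg hτ (w - Y + Z' - X), theta1_neg hτ (w - X)] at key
  rw [← add_div, div_eq_one_iff_eq (mul_ne_zero (mul_ne_zero (mul_ne_zero h1 h2) h3) h4)]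
  linear_combination -key
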